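/- For every positive integer k, there exists a morphic sequence α whose factor complexity satisfies P_α(n) = Θ(n^{1+1/k}). -/

import Mathlib

open Filter Asymptotics

variable {A : Type*}

/-- Extension of a morphism, given on letters, to words. -/
def wordMap (φ : A → List A) (w : List A) : List A := w.flatMap φ

/-- The factor of the infinite word α of length n starting at position i. -/
def factorAt (α : ℕ → A) (i n : ℕ) : List A := (List.range n).map (fun j => α (i + j))

/-- w is a factor (contiguous subword) of the infinite word α. -/
def IsFactor (α : ℕ → A) (w : List A) : Prop := ∃ i, w = factorAt α i w.length

/-- The factor complexity of α: the number of distinct factors of length n. -/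
noncomputable def complexity (α : ℕ → A) (n : ℕ) : ℕ :=
  Set.ncard {w : List A | w.length = n ∧ IsFactor α w}

def UltimatelyPeriodic (α : ℕ → A) : Prop :=
  ∃ N p : ℕ, 1 ≤ p ∧ ∀ i, N ≤ i → α (i + p) = α i

/-- φ is prolongable on a: φ(a) = a·w with w nonempty and |φ^n(a)| → ∞. -/
def Prolongable (φ : A → List A) (a : A) : Prop :=
  (∃ w, w ≠ [] ∧ φ a = a :: w) ∧
    Tendsto (fun n => ((wordMap φ)^[n] [a]).length) atTop atTop

/-- α is the pure morphic sequence φ^∞(a): every iterate φ^n(a) is a prefix of α. -/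
def IsFixedSeq (φ : A → List A) (a : A) (α : ℕ → A) : Prop :=
  ∀ n, factorAt α 0 ((wordMap φ)^[n] [a]).length = (wordMap φ)^[n] [a]

/-- The letter b is growing for φ: |φ^k(b)| → ∞. -/
def GrowingLetter (φ : A → List A) (b : A) : Prop :=
  Tendsto (fun k => ((wordMap φ)^[k] [b]).length) atTop atTop

def BoundedLetter (φ : A → List A) (b : A) : Prop := ¬ GrowingLetter φ b

/-- φ is growing: every letter is growing. -/
def Growing (φ : A → List A) : Prop := ∀ b, GrowingLetter φ b

/-- The number of subsets of size at most `m` of an `n`-element set; it is the length of the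
`n`-th iterate of `descend` on the letter `m`. -/
def binomSum : ℕ → ℕ → ℕ
  | 0, _ => 1
  | _ + 1, 0 => 1
  | m + 1, n + 1 => binomSum (m + 1) n + binomSum m n

theorem binomSum_zero_right (m : ℕ) : binomSum m 0 = 1 := by
  cases m <;> simp [binomSum]

theorem binomSum_pos (m n : ℕ) : 0 < binomSum m n := by
  induction n with
  | zero => simp [binomSum_zero_right]
  | succ n ih => cases m <;> simp [binomSum]; omega

theorem binomSum_succ_strictMono (m : ℕ) : StrictMono (binomSum (m + 1)) :=
  strictMono_nat_of_lt_succ fun n => by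
    have := binomSum_pos m n
    simp only [binomSum]; omega

theorem binomSum_le (m n : ℕ) : binomSum m n ≤ (n + 1) ^ m := by
  induction n generalizing m with
  | zero => simp [binomSum_zero_right]
  | succ n ih =>
    cases m with
    | zero => simp [binomSum]
    | succ m =>
      calc binomSum (m + 1) n + binomSum m n ≤ (n + 1) ^ (m + 1) + (n + 1) ^ m :=
            add_le_add (ih _) (ih _)
        _ = (n + 1) ^ m * (n + 1 + 1) := by ring
        _ ≤ (n + 1 + 1) ^ m * (n + 1 + 1) := by gcongr; omega
        _ = (n + 1 + 1) ^ (m + 1) := by ring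

theorem succ_pow_succ_le (x m : ℕ) :
    (x + 1) ^ (m + 1) ≤ x ^ (m + 1) + (m + 1) * (x + 1) ^ m := by
  induction m with
  | zero => simp
  | succ m ih =>
    have h : x ^ (m + 1) ≤ (x + 1) ^ (m + 1) := by gcongr; omega
    calc (x + 1) ^ (m + 1 + 1) = (x + 1) ^ (m + 1) * (x + 1) := by ring
      _ ≤ (x ^ (m + 1) + (m + 1) * (x + 1) ^ m) * (x + 1) := by gcongr
      _ = x ^ (m + 1 + 1) + x ^ (m + 1) + (m + 1) * (x + 1) ^ (m + 1) := by ring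
      _ ≤ x ^ (m + 1 + 1) + (x + 1) ^ (m + 1) + (m + 1) * (x + 1) ^ (m + 1) := by gcongr
      _ = x ^ (m + 1 + 1) + (m + 1 + 1) * (x + 1) ^ (m + 1) := by ring

theorem exists_pow_le_mul_binomSum (m : ℕ) :
    ∃ C : ℕ, 1 ≤ C ∧ ∀ n, (n + 1) ^ m ≤ C * binomSum m n := by
  induction m with
  | zero => exact ⟨1, le_rfl, by simp [binomSum]⟩
  | succ m ih =>
    obtain ⟨C, hC, h⟩ := ih
    have hpos : 1 ≤ (m + 1) * 2 ^ m * C := Nat.mul_pos (by positivity) hC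
    refine ⟨(m + 1) * 2 ^ m * C, hpos, fun n => ?_⟩
    induction n with
    | zero => simpa [binomSum] using hpos
    | succ n ihn =>
      have h2 : (n + 1 + 1) ^ m ≤ 2 ^ m * (n + 1) ^ m := by
        rw [← mul_pow]; gcongr; omega
      calc (n + 1 + 1) ^ (m + 1) ≤ (n + 1) ^ (m + 1) + (m + 1) * (n + 1 + 1) ^ m :=
            succ_pow_succ_le _ _
        _ ≤ (m + 1) * 2 ^ m * C * binomSum (m + 1) n
              + (m + 1) * (2 ^ m * (C * binomSum m n)) := by
            gcongr
            exact h2.trans (by gcongr; exact h n)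
        _ = (m + 1) * 2 ^ m * C * binomSum (m + 1) (n + 1) := by simp only [binomSum]; ring

/-- The morphism fixing the letter `0` and sending every other letter `i` to `i (i - 1)`. -/
def descend (k : ℕ) : Fin (k + 1) → List (Fin (k + 1)) :=
  Fin.cases [0] fun j => [j.succ, j.castSucc]

theorem iterate_wordMap_append (φ : A → List A) (n : ℕ) (u v : List A) :
    (wordMap φ)^[n] (u ++ v) = (wordMap φ)^[n] u ++ (wordMap φ)^[n] v := by
  induction n generalizing u v with
  | zero => rfl
  | succ n ih => simp [Function.iterate_succ_apply, wordMap, List.flatMap_append, ih]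

theorem iterate_descend_zero (k n : ℕ) : (wordMap (descend k))^[n] [0] = [0] :=
  Function.iterate_fixed (by simp [wordMap, descend]) n

theorem iterate_descend_succ (k n : ℕ) (j : Fin k) :
    (wordMap (descend k))^[n + 1] [j.succ] =
      (wordMap (descend k))^[n] [j.succ] ++ (wordMap (descend k))^[n] [j.castSucc] := by
  rw [← iterate_wordMap_append, Function.iterate_succ_apply]
  simp [wordMap, descend]

theorem length_iterate_descend (k n : ℕ) (i : Fin (k + 1)) :
    ((wordMap (descend k))^[n] [i]).length = binomSum i n := by
  induction n generalizing i with
  | zero => simp [binomSum_zero_right]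
  | succ n ih =>
    cases i using Fin.cases with
    | zero => simp [iterate_descend_zero, binomSum]
    | succ j => simp [iterate_descend_succ, ih, binomSum]

theorem le_of_mem_iterate_descend (k n : ℕ) (i : Fin (k + 1)) :
    ∀ b ∈ (wordMap (descend k))^[n] [i], b ≤ i := by
  induction n generalizing i with
  | zero => simp
  | succ n ih =>
    cases i using Fin.cases with
    | zero => simp [iterate_descend_zero]
    | succ j =>
      intro b hb
      rw [iterate_descend_succ, List.mem_append] at hb
      exact hb.elim (ih _ _) fun h => (ih _ _ h).trans (Fin.castSucc_lt_succ).le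

theorem iterate_descend_eq_cons (k n : ℕ) (i : Fin (k + 1)) :
    ∃ w, (wordMap (descend k))^[n] [i] = i :: w ∧ ∀ b ∈ w, b < i := by
  induction n generalizing i with
  | zero => exact ⟨[], by simp⟩
  | succ n ih =>
    cases i using Fin.cases with
    | zero => exact ⟨[], by simp [iterate_descend_zero]⟩
    | succ j =>
      obtain ⟨w, hw, hlt⟩ := ih j.succ
      refine ⟨w ++ (wordMap (descend k))^[n] [j.castSucc],
        by simp [iterate_descend_succ, hw], fun b hb => ?_⟩
      rw [List.mem_append] at hb
      exact hb.elim (hlt b) fun h =>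
        (le_of_mem_iterate_descend _ _ _ _ h).trans_lt Fin.castSucc_lt_succ

theorem iterate_descend_prefix_of_le (k : ℕ) (i : Fin (k + 1)) {n n' : ℕ} (h : n ≤ n') :
    (wordMap (descend k))^[n] [i] <+: (wordMap (descend k))^[n'] [i] := by
  induction h with
  | refl => exact List.prefix_rfl
  | step _ ih =>
    refine ih.trans ?_
    cases i using Fin.cases with
    | zero => simp [iterate_descend_zero]
    | succ j => exact iterate_descend_succ k _ j ▸ List.prefix_append _ _

/-- The fixed point of `descend (k + 1)` starting with the largest letter. -/
def descendSeq (k i : ℕ) : Fin (k + 2) :=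
  ((wordMap (descend (k + 1)))^[i] [Fin.last (k + 1)]).getD i 0

theorem getElem?_iterate_descend (k n i : ℕ) (h : i < binomSum (k + 1) n) :
    ((wordMap (descend (k + 1)))^[n] [Fin.last (k + 1)])[i]? = some (descendSeq k i) := by
  have hi : i < binomSum (k + 1) i := by
    have := (binomSum_succ_strictMono k).add_le_nat i 0
    simp only [binomSum_zero_right, add_zero] at this
    omega
  have hl := (length_iterate_descend (k + 1) · (Fin.last (k + 1)))
  simp only [Fin.val_last] at hl
  have hi' : i < ((wordMap (descend (k + 1)))^[i] [Fin.last (k + 1)]).length := by rwa [hl]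
  have hn' : i < ((wordMap (descend (k + 1)))^[n] [Fin.last (k + 1)]).length := by rwa [hl]
  rw [descendSeq, List.getD_eq_getElem _ _ hi', List.getElem?_eq_getElem hn', Option.some_inj]
  rcases le_total n i with hni | hni
  · exact (iterate_descend_prefix_of_le _ _ hni).getElem hn'
  · exact ((iterate_descend_prefix_of_le _ _ hni).getElem hi').symm

theorem isFixedSeq_descendSeq (k : ℕ) :
    IsFixedSeq (descend (k + 1)) (Fin.last (k + 1)) (descendSeq k) := by
  intro n
  apply List.ext_getElem?
  intro i
  rw [length_iterate_descend, Fin.val_last]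
  rcases lt_or_ge i (binomSum (k + 1) n) with h | h
  · rw [getElem?_iterate_descend k n i h]
    simp [factorAt, h]
  · rw [List.getElem?_eq_none, List.getElem?_eq_none]
    · simpa [length_iterate_descend] using h
    · simpa [factorAt] using h

theorem prolongable_descend (k : ℕ) :
    Prolongable (descend (k + 1)) (Fin.last (k + 1)) := by
  refine ⟨⟨[(Fin.last k).castSucc], by simp, ?_⟩, ?_⟩
  · rw [← Fin.succ_last]; rfl
  · simp only [length_iterate_descend, Fin.val_last]
    exact (binomSum_succ_strictMono k).tendsto_atTop

/-- The coding marking the two largest letters. -/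
def markTop (k : ℕ) (i : Fin (k + 2)) : Fin 2 := if k ≤ i.val then 1 else 0

theorem getElem?_block (k n t : ℕ) (ht : t < binomSum k n) :
    ((wordMap (descend (k + 1)))^[n] [(Fin.last k).castSucc])[t]? =
      some (descendSeq k (binomSum (k + 1) n + t)) := by
  rw [← getElem?_iterate_descend k (n + 1) _ (by simp only [binomSum]; omega), ← Fin.succ_last,
    iterate_descend_succ, List.getElem?_append_right]
  · simp [length_iterate_descend]
  · simp [length_iterate_descend]

theorem markTop_descendSeq_start (k n : ℕ) :
    markTop k (descendSeq k (binomSum (k + 1) n)) = 1 := by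
  have h := getElem?_block k n 0 (binomSum_pos k n)
  obtain ⟨w, hw, -⟩ := iterate_descend_eq_cons (k + 1) n (Fin.last k).castSucc
  rw [hw] at h
  simp only [List.getElem?_cons_zero, Option.some_inj, add_zero] at h
  simp [← h, markTop]

theorem markTop_descendSeq_inner (k n t : ℕ) (h0 : 0 < t) (ht : t < binomSum k n) :
    markTop k (descendSeq k (binomSum (k + 1) n + t)) = 0 := by
  have h := getElem?_block k n t ht
  obtain ⟨w, hw, hlt⟩ := iterate_descend_eq_cons (k + 1) n (Fin.last k).castSucc
  obtain ⟨t, rfl⟩ := Nat.exists_eq_add_one_of_ne_zero h0.ne'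
  rw [hw, List.getElem?_cons_succ] at h
  have := hlt _ (List.mem_of_getElem? h)
  rw [Fin.lt_def] at this
  simp only [Fin.val_castSucc, Fin.val_last] at this
  simp [markTop, this]

theorem factorAt_length (α : ℕ → A) (i n : ℕ) : (factorAt α i n).length = n := by
  simp [factorAt]

theorem factorAt_eq_iff (α β : ℕ → A) (i j n : ℕ) :
    factorAt α i n = factorAt β j n ↔ ∀ u < n, α (i + u) = β (j + u) := by
  simp [factorAt]

theorem setOf_isFactor_eq_range (α : ℕ → A) (n : ℕ) :
    {w : List A | w.length = n ∧ IsFactor α w} = Set.range (factorAt α · n) := by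
  ext w
  constructor
  · rintro ⟨rfl, i, hi⟩
    exact ⟨i, hi.symm⟩
  · rintro ⟨i, rfl⟩
    exact ⟨factorAt_length _ _ _, i, by simp [factorAt_length]⟩

/-- `β` is a binary word whose ones, apart from position `0`, are at the positions `S j`, with
`S 0 = 1` and strictly increasing gaps `L j`. -/
structure SparseOnes (β : ℕ → Fin 2) (S L : ℕ → ℕ) : Prop where
  start : S 0 = 1
  succ : ∀ j, S (j + 1) = S j + L j
  gap_pos : ∀ j, 0 < L j
  gap_strictMono : StrictMono L
  one : ∀ j, β (S j) = 1
  zero : ∀ j t, 0 < t → t < L j → β (S j + t) = 0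

namespace SparseOnes

variable {β : ℕ → Fin 2} {S L : ℕ → ℕ}

theorem strictMono (h : SparseOnes β S L) : StrictMono S :=
  strictMono_nat_of_lt_succ fun j => by
    have := h.gap_pos j
    rw [h.succ]; omega

theorem exists_block (h : SparseOnes β S L) {i : ℕ} (hi : 1 ≤ i) :
    ∃ j t, t < L j ∧ i = S j + t := by
  induction i, hi using Nat.le_induction with
  | base => exact ⟨0, 0, h.gap_pos 0, by simp [h.start]⟩
  | succ i _ ih =>
    obtain ⟨j, t, ht, rfl⟩ := ih
    rcases Nat.lt_or_ge (t + 1) (L j) with h1 | h1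
    · exact ⟨j, t + 1, h1, rfl⟩
    · exact ⟨j + 1, 0, h.gap_pos _, by rw [h.succ]; omega⟩

theorem exists_eq_of_one (h : SparseOnes β S L) {i : ℕ} (hi : 1 ≤ i) (h1 : β i = 1) :
    ∃ j, i = S j := by
  obtain ⟨j, t, ht, rfl⟩ := h.exists_block hi
  rcases Nat.eq_zero_or_pos t with rfl | h0
  · exact ⟨j, rfl⟩
  · simp [h.zero j t h0 ht] at h1

theorem factorAt_of_le (h : SparseOnes β S L) {n J i : ℕ} (hJ : n ≤ L J) (hi : S J ≤ i) :
    ∃ p < n + 1, factorAt β i n = factorAt (fun u => if u = p then 1 else 0) 0 n := by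
  obtain ⟨j, t, ht, rfl⟩ := h.exists_block (i := i) (by
    have := h.strictMono.monotone (Nat.zero_le J); rw [h.start] at this; omega)
  have hj : J ≤ j := by
    by_contra hlt
    have h1 := h.strictMono.monotone (show j + 1 ≤ J by omega)
    rw [h.succ] at h1; omega
  have hn : n ≤ L j := hJ.trans (h.gap_strictMono.monotone hj)
  have hn1 : n ≤ L (j + 1) := hn.trans (h.gap_strictMono.monotone j.le_succ)
  rcases Nat.eq_zero_or_pos t with rfl | h0
  · refine ⟨0, by omega, (factorAt_eq_iff ..).2 fun u hu => ?_⟩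
    rcases Nat.eq_zero_or_pos u with rfl | hu0
    · simp [h.one]
    · simp [hu0.ne', h.zero j u hu0 (by omega)]
  · refine ⟨min (L j - t) n, by omega, (factorAt_eq_iff ..).2 fun u hu => ?_⟩
    rcases lt_trichotomy u (L j - t) with hlt | heq | hgt
    · rw [if_neg (by omega), add_assoc, h.zero j _ (by omega) (by omega)]
    · rw [if_pos (by omega), show S j + t + u = S (j + 1) by rw [h.succ]; omega, h.one]
    · rw [if_neg (by omega),
        show S j + t + u = S (j + 1) + (u - (L j - t)) by rw [h.succ]; omega,
        h.zero _ _ (by omega) (by omega)]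

theorem range_factorAt_subset (h : SparseOnes β S L) {n J : ℕ} (hJ : n ≤ L J) :
    Set.range (factorAt β · n) ⊆
      (((Finset.range (S J)).image (factorAt β · n) ∪ (Finset.range (n + 1)).image
        fun p => factorAt (fun u => if u = p then (1 : Fin 2) else 0) 0 n : Finset _) :
          Set (List (Fin 2))) := by
  rintro _ ⟨i, rfl⟩
  simp only [Finset.coe_union, Finset.coe_image, Finset.coe_range]
  rcases lt_or_ge i (S J) with hi | hi
  · exact Or.inl ⟨i, hi, rfl⟩
  · obtain ⟨p, hp, he⟩ := h.factorAt_of_le hJ hi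
    exact Or.inr ⟨p, hp, he.symm⟩

theorem complexity_le (h : SparseOnes β S L) {n J : ℕ} (hJ : n ≤ L J) :
    complexity β n ≤ S J + (n + 1) := by
  rw [complexity, setOf_isFactor_eq_range]
  refine (Set.ncard_le_ncard (h.range_factorAt_subset hJ) (Finset.finite_toSet _)).trans ?_
  rw [Set.ncard_coe_finset]
  refine (Finset.card_union_le _ _).trans (add_le_add ?_ ?_)
  · exact Finset.card_image_le.trans_eq (Finset.card_range _)
  · exact Finset.card_image_le.trans_eq (Finset.card_range _)

theorem exists_gap_in_window (h : SparseOnes β S L) {n M i : ℕ} (hM : 2 * L M ≤ n)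
    (hi : 1 ≤ i) (hiM : i ≤ S M) : ∃ a, i ≤ S a ∧ S a + L a < i + n := by
  have hex : ∃ a, i ≤ S a := ⟨M, hiM⟩
  classical
  have hle : Nat.find hex ≤ M := Nat.find_min' hex hiM
  have hLle := h.gap_strictMono.monotone hle
  have hpos := h.gap_pos M
  refine ⟨Nat.find hex, Nat.find_spec hex, ?_⟩
  rcases Nat.eq_zero_or_pos (Nat.find hex) with h0 | h0
  · rw [h0] at hLle ⊢
    rw [h.start]; omega
  · obtain ⟨b, hb⟩ := Nat.exists_eq_add_one_of_ne_zero h0.ne'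
    have hlt : S b < i := not_le.1 (Nat.find_min hex (by omega))
    rw [hb] at hLle ⊢
    have := h.gap_strictMono b.lt_succ_self
    simp only [Nat.succ_eq_add_one] at this
    rw [h.succ]; omega

theorem factorAt_ne (h : SparseOnes β S L) {n M i i' : ℕ} (hM : 2 * L M ≤ n)
    (hi : 1 ≤ i) (hii : i < i') (hiM : i ≤ S M) : factorAt β i n ≠ factorAt β i' n := by
  intro he
  rw [factorAt_eq_iff] at he
  obtain ⟨a, hia, han⟩ := h.exists_gap_in_window hM hi hiM
  have h1 := he (S a - i) (by have := h.gap_pos a; omega)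
  rw [Nat.add_sub_cancel' hia, h.one] at h1
  obtain ⟨b, hb⟩ := h.exists_eq_of_one (by omega) h1.symm
  have hab : a < b := h.strictMono.lt_iff_lt.1 (by omega)
  have h2 := he (S a - i + L a) (by omega)
  rw [show i + (S a - i + L a) = S (a + 1) by rw [h.succ]; omega, h.one, ← add_assoc, hb,
    h.zero b _ (h.gap_pos a) (h.gap_strictMono hab)] at h2
  simp at h2

theorem le_complexity (h : SparseOnes β S L) {n M : ℕ} (hM : 2 * L M ≤ n) :
    S M ≤ complexity β n := by
  have hinj : Set.InjOn (factorAt β · n) (Finset.Icc 1 (S M) : Finset ℕ) := by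
    intro i hi i' hi' he
    rw [Finset.coe_Icc, Set.mem_Icc] at hi hi'
    rcases lt_trichotomy i i' with hlt | heq | hgt
    · exact absurd he (h.factorAt_ne hM hi.1 hlt hi.2)
    · exact heq
    · exact absurd he.symm (h.factorAt_ne hM hi'.1 hgt hi'.2)
  have hfin : (Set.range (factorAt β · n)).Finite :=
    (Finset.finite_toSet _).subset
      (h.range_factorAt_subset (h.gap_strictMono.le_apply : n ≤ L n))
  rw [complexity, setOf_isFactor_eq_range]
  calc S M = ((Finset.Icc 1 (S M)).image (factorAt β · n)).card := by
        rw [Finset.card_image_of_injOn hinj]; simp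
    _ = (((Finset.Icc 1 (S M)).image (factorAt β · n) : Finset _) : Set _).ncard :=
        (Set.ncard_coe_finset _).symm
    _ ≤ _ := Set.ncard_le_ncard (by rw [Finset.coe_image]; exact Set.image_subset_range _ _) hfin

end SparseOnes

theorem sparseOnes_markTop (k : ℕ) : SparseOnes
    (fun i => markTop (k + 1) (descendSeq (k + 1) i)) (binomSum (k + 2)) (binomSum (k + 1)) where
  start := binomSum_zero_right _
  succ _ := by simp [binomSum]
  gap_pos := binomSum_pos _
  gap_strictMono := binomSum_succ_strictMono k
  one := markTop_descendSeq_start _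
  zero := markTop_descendSeq_inner _

theorem rpow_inv_pow_succ {k : ℕ} (hk : 1 ≤ k) {x : ℝ} (hx : 0 < x) :
    (x ^ (1 / k : ℝ)) ^ (k + 1) = x ^ (1 + 1 / k : ℝ) := by
  rw [← Real.rpow_natCast, ← Real.rpow_mul hx.le]
  congr 1
  have : (k : ℝ) ≠ 0 := by positivity
  push_cast
  field_simp

theorem complexity_markTop_isBigO (k : ℕ) :
    (fun n => (complexity (fun i => markTop (k + 1) (descendSeq (k + 1) i)) n : ℝ)) =O[atTop]
      (fun n : ℕ => ((n : ℝ) ^ (1 / (k + 1 : ℕ) : ℝ)) ^ (k + 2)) := by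
  obtain ⟨C, hC, hlow⟩ := exists_pow_le_mul_binomSum (k + 1)
  refine IsBigO.of_bound ((C + 2 : ℝ) ^ (k + 2) + 2) ?_
  filter_upwards [eventually_ge_atTop 1] with n hn
  set x : ℝ := (n : ℝ) ^ (1 / (k + 1 : ℕ) : ℝ) with hx
  have hn' : (1 : ℝ) ≤ n := by exact_mod_cast hn
  have hx1 : 1 ≤ x := Real.one_le_rpow hn' (by positivity)
  have hxn : x ^ (k + 1) = n := by
    rw [hx, one_div]; exact Real.rpow_inv_natCast_pow (by positivity) (by omega)
  have hC' : (1 : ℝ) ≤ C := by exact_mod_cast hC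
  have hJ : n ≤ binomSum (k + 1) ⌈C * x⌉₊ := by
    refine Nat.le_of_mul_le_mul_left (le_trans ?_ (hlow _)) hC
    rify
    calc (C : ℝ) * n ≤ C ^ (k + 1) * n := by
          gcongr; exact le_self_pow₀ hC' (by omega)
      _ = (C * x) ^ (k + 1) := by rw [mul_pow, hxn]
      _ ≤ (⌈C * x⌉₊ + 1) ^ (k + 1) := by
          gcongr; exact (Nat.le_ceil _).trans (by linarith)
  have h1 : (complexity (fun i => markTop (k + 1) (descendSeq (k + 1) i)) n : ℝ) ≤
      (⌈C * x⌉₊ + 1) ^ (k + 2) + (n + 1) := by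
    exact_mod_cast ((sparseOnes_markTop k).complexity_le hJ).trans
      (Nat.add_le_add_right (binomSum_le _ _) _)
  have h2 : ((⌈C * x⌉₊ : ℝ) + 1) ^ (k + 2) ≤ (C + 2) ^ (k + 2) * x ^ (k + 2) := by
    rw [← mul_pow]
    gcongr
    have := Nat.ceil_lt_add_one (show 0 ≤ C * x by positivity)
    linarith
  have h3 : (n : ℝ) ≤ x ^ (k + 2) := by
    rw [← hxn]; exact pow_le_pow_right₀ hx1 (by omega)
  rw [Real.norm_of_nonneg (by positivity), Real.norm_of_nonneg (by positivity)]
  linarith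

theorem isBigO_complexity_markTop (k : ℕ) :
    (fun n : ℕ => ((n : ℝ) ^ (1 / (k + 1 : ℕ) : ℝ)) ^ (k + 2)) =O[atTop]
      (fun n => (complexity (fun i => markTop (k + 1) (descendSeq (k + 1) i)) n : ℝ)) := by
  obtain ⟨C, hC, hlow⟩ := exists_pow_le_mul_binomSum (k + 2)
  refine IsBigO.of_bound (4 ^ (k + 2) * C : ℝ) ?_
  filter_upwards [eventually_ge_atTop (2 ^ (k + 1))] with n hn
  set x : ℝ := (n : ℝ) ^ (1 / (k + 1 : ℕ) : ℝ) with hx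
  have hxn : x ^ (k + 1) = n := by
    rw [hx, one_div]; exact Real.rpow_inv_natCast_pow (by positivity) (by omega)
  have hx0 : 0 ≤ x := by positivity
  have hx2 : 2 ≤ x := by
    refine le_of_pow_le_pow_left₀ (n := k + 1) (by omega) hx0 ?_
    rw [hxn]; exact_mod_cast hn
  obtain ⟨M, hM⟩ : ∃ M, ⌊x / 2⌋₊ = M + 1 :=
    Nat.exists_eq_add_one_of_ne_zero (Nat.floor_pos.2 (by linarith)).ne'
  have hMle : (M + 1 : ℝ) ≤ x / 2 := by
    have := Nat.floor_le (show 0 ≤ x / 2 by positivity)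
    rw [hM] at this; exact_mod_cast this
  have hMge : x ≤ 4 * (M + 1 : ℝ) := by
    have := Nat.lt_floor_add_one (x / 2)
    rw [hM] at this; push_cast at this
    have : (0 : ℝ) ≤ M := by positivity
    linarith
  have hL : 2 * binomSum (k + 1) M ≤ n := by
    refine (Nat.mul_le_mul_left 2 (binomSum_le _ _)).trans ?_
    rify
    calc (2 : ℝ) * (M + 1) ^ (k + 1) ≤ 2 ^ (k + 1) * (x / 2) ^ (k + 1) := by
          gcongr; exact le_self_pow₀ (by norm_num) (by omega)
      _ = n := by rw [← mul_pow, mul_div_cancel₀ _ (by norm_num), hxn]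
  have h1 : ((M + 1 : ℝ)) ^ (k + 2) ≤
      C * (complexity (fun i => markTop (k + 1) (descendSeq (k + 1) i)) n : ℝ) := by
    exact_mod_cast (hlow M).trans
      (Nat.mul_le_mul_left C ((sparseOnes_markTop k).le_complexity hL))
  rw [Real.norm_of_nonneg (by positivity), Real.norm_of_nonneg (by positivity)]
  calc x ^ (k + 2) ≤ (4 * (M + 1 : ℝ)) ^ (k + 2) := by gcongr
    _ = 4 ^ (k + 2) * (M + 1 : ℝ) ^ (k + 2) := mul_pow _ _ _
    _ ≤ 4 ^ (k + 2) * (C * _) := by gcongr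
    _ = _ := by ring

/-- Pansiot: for every k ≥ 1 there is a morphic sequence of complexity Θ(n^(1+1/k)). -/
theorem exists_morphic_of_complexity (k : ℕ) (hk : 1 ≤ k) :
    ∃ (m d : ℕ) (φ : Fin m → List (Fin m)) (a : Fin m) (ψ : Fin m → Fin d) (α : ℕ → Fin m),
      Prolongable φ a ∧ IsFixedSeq φ a α ∧
      (fun n => (complexity (fun i => ψ (α i)) n : ℝ)) =Θ[atTop]
        (fun n => (n : ℝ) ^ ((1 : ℝ) + 1 / k)) := by
  obtain ⟨k, rfl⟩ := Nat.exists_eq_add_one_of_ne_zero (Nat.one_le_iff_ne_zero.1 hk)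
  refine ⟨k + 3, 2, descend (k + 2), Fin.last (k + 2), markTop (k + 1), descendSeq (k + 1),
    prolongable_descend _, isFixedSeq_descendSeq _, ?_⟩
  refine IsTheta.trans_eventuallyEq
    ⟨complexity_markTop_isBigO k, isBigO_complexity_markTop k⟩ ?_
  filter_upwards [eventually_gt_atTop 0] with n hn
  exact rpow_inv_pow_succ hk (by exact_mod_cast hn)
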